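/- arXiv:2303.05626 — 2 statements merged into one kernel-verified Lean document; each statement's English description precedes it below -/
import Mathlib

section
/- Let n ≥ 3 and 1 ≤ m < n. Define the subset S_m of ℤ/nℤ as follows: if m is even, S_m := {(j : ℤ/nℤ) | 1 ≤ j ≤ m/2} ∪ {(−j : ℤ/nℤ) | 1 ≤ j ≤ m/2}; if m is odd, S_m := {(j : ℤ/nℤ) | 1 ≤ j ≤ (m−1)/2} ∪ {(−j : ℤ/nℤ) | 1 ≤ j ≤ (m−1)/2} ∪ {((m+1)/2 : ℤ/nℤ)}. (Since m < n, S_m consists of m distinct nonzero elements.) Then both the generation degree and the full-rank degree of the lattice L(S_m) := {a : S_m → ℤ | Σ_{A∈S_m} a(A) • A = 0 in ℤ/nℤ} are equal to max(3, ⌈n / ⌈m/2⌉⌉). (Paper's Proposition: β_field(ℤ/nℤ, S_m) = γ_field(ℤ/nℤ, S_m) = max(3, ⌈n/⌈m/2⌉⌉).) -/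
/-- For a finite subset `S` of `ℤ/nℤ`, the lattice `L(S) ⊆ ℤ^S`: functions `ZMod n → ℤ`
vanishing outside `S` (the copy of `ℤ^S` inside `ℤ^{ℤ/nℤ}`) whose `S`-weighted sum vanishes
in `ℤ/nℤ`. -/
def latFin {n : ℕ} (S : Finset (ZMod n)) : AddSubgroup (ZMod n → ℤ) where
  carrier := {a | (∀ χ ∉ S, a χ = 0) ∧ ∑ χ ∈ S, a χ • χ = 0}
  zero_mem' := by simp
  add_mem' := by
    intro a b ha hb
    refine ⟨fun χ hχ => ?_, ?_⟩
    · simp [ha.1 χ hχ, hb.1 χ hχ]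
    · have h2 : ∑ χ ∈ S, (a + b) χ • χ = (∑ χ ∈ S, a χ • χ) + ∑ χ ∈ S, b χ • χ := by
        simp [Pi.add_apply, add_smul, Finset.sum_add_distrib]
      rw [h2, ha.2, hb.2, add_zero]
  neg_mem' := by
    intro a ha
    refine ⟨fun χ hχ => ?_, ?_⟩
    · simp [ha.1 χ hχ]
    · have h2 : ∑ χ ∈ S, (-a) χ • χ = -∑ χ ∈ S, a χ • χ := by
        simp [Pi.neg_apply, neg_smul, Finset.sum_neg_distrib]
      rw [h2, ha.2, neg_zero]

/-- `L(S)` is generated in degree `≤ d`. -/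
def genLE {n : ℕ} (S : Finset (ZMod n)) (d : ℕ) : Prop :=
  AddSubgroup.closure
      {a | a ∈ latFin S ∧ (∀ χ, 0 ≤ a χ) ∧ ∑ χ ∈ S, a χ ≤ (d : ℤ)} = latFin S

/-- `L(S)` has full-rank degree `≤ d`: it contains `|S|` `ℤ`-linearly independent
nonnegative elements of degree `≤ d`. -/
def frLE {n : ℕ} (S : Finset (ZMod n)) (d : ℕ) : Prop :=
  ∃ a : Fin S.card → (ZMod n → ℤ), (∀ j, a j ∈ latFin S) ∧ LinearIndependent ℤ a ∧
    (∀ j χ, 0 ≤ a j χ) ∧ ∀ j, ∑ χ ∈ S, a j χ ≤ (d : ℤ)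

/-- Ceiling division of natural numbers: `cdiv a b = ⌈a / b⌉`. -/
def cdiv (a b : ℕ) : ℕ := (a + b - 1) / b

/-- The extremal set `S_m ⊆ ℤ/nℤ`: for even `m`, `{±1, …, ±(m/2)}`; for odd `m`,
`{±1, …, ±((m−1)/2)} ∪ {(m+1)/2}`. -/
def Sm (n m : ℕ) : Finset (ZMod n) :=
  if m % 2 = 0 then
    ((Finset.Icc 1 (m / 2)).image fun j : ℕ => (j : ZMod n)) ∪
      ((Finset.Icc 1 (m / 2)).image fun j : ℕ => -(j : ZMod n))
  else
    ((Finset.Icc 1 ((m - 1) / 2)).image fun j : ℕ => (j : ZMod n)) ∪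
      ((Finset.Icc 1 ((m - 1) / 2)).image fun j : ℕ => -(j : ZMod n)) ∪
      {(((m + 1) / 2 : ℕ) : ZMod n)}

/-- Integer vectors orthogonal to a vector that is nonzero somewhere on `S` do not contain a
linearly independent family of size `|S|`. -/
lemma not_frLE_of_orthogonal {n : ℕ} {S : Finset (ZMod n)} {d : ℕ} (v : ZMod n → ℤ) (c : ZMod n)
    (hc : c ∈ S) (hv : v c ≠ 0)
    (h : ∀ a ∈ latFin S, (∀ χ, 0 ≤ a χ) → ∑ χ ∈ S, a χ ≤ (d : ℤ) → ∑ χ ∈ S, a χ * v χ = 0) :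
    ¬ frLE S d := by
  rintro ⟨a, ha, hli, hnn, hdeg⟩
  let e := S.equivFin
  let M : Matrix S S ℤ := fun i χ => a (e i) χ
  have hdet : M.det = 0 := by
    rw [← Matrix.exists_mulVec_eq_zero_iff]
    refine ⟨fun χ => v χ, fun h0 => hv (congrFun h0 ⟨c, hc⟩), ?_⟩
    ext i
    have := h _ (ha (e i)) (hnn _) (hdeg _)
    rw [← Finset.sum_coe_sort] at this
    simpa [Matrix.mulVec, dotProduct, M] using this
  rw [← Matrix.exists_vecMul_eq_zero_iff] at hdet
  obtain ⟨u, hu0, hu⟩ := hdet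
  apply hu0
  have hli' : LinearIndependent ℤ (a ∘ e) := hli.comp _ e.injective
  rw [Fintype.linearIndependent_iff] at hli'
  ext i
  refine hli' u ?_ i
  ext χ
  by_cases hχ : χ ∈ S
  · have := congrFun hu ⟨χ, hχ⟩
    simpa [Matrix.vecMul, dotProduct, M] using this
  · simp only [Finset.sum_apply, Pi.smul_apply, Function.comp_apply, Pi.zero_apply]
    exact Finset.sum_eq_zero fun j _ => by simp [(ha (e j)).1 χ hχ]

lemma single_nsmul_mem_latFin {n : ℕ} {S : Finset (ZMod n)} {c : ZMod n} (hc : c ∈ S) :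
    Pi.single c (n : ℤ) ∈ latFin S := by
  refine ⟨fun χ hχ => Pi.single_eq_of_ne (ne_of_mem_of_not_mem hc hχ).symm _, ?_⟩
  rw [Finset.sum_eq_single_of_mem c hc]
  · simp
  · intro b _ hb
    simp [Pi.single_eq_of_ne hb]

/-- Generators of `L(S)` contain a full-rank independent family. -/
lemma genLE.frLE {n : ℕ} (hn : n ≠ 0) {S : Finset (ZMod n)} {d : ℕ} (h : genLE S d) :
    frLE S d := by
  let φ : (ZMod n → ℤ) →ₗ[ℤ] (S → ℚ) :=
    { toFun := fun a χ => (a χ : ℚ)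
      map_add' := fun a b => by ext; simp
      map_smul' := fun r a => by ext; simp }
  set G : Set (ZMod n → ℤ) :=
    {a | a ∈ latFin S ∧ (∀ χ, 0 ≤ a χ) ∧ ∑ χ ∈ S, a χ ≤ (d : ℤ)}
  have hmem : ∀ a ∈ latFin S, φ a ∈ Submodule.span ℚ (φ '' G) := by
    intro a ha
    rw [← h] at ha
    induction ha using AddSubgroup.closure_induction with
    | mem x hx => exact Submodule.subset_span ⟨x, hx, rfl⟩
    | zero => simp
    | add x y _ _ hx hy => rw [map_add]; exact add_mem hx hy
    | neg x _ hx => rw [map_neg]; exact neg_mem hx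
  have htop : Submodule.span ℚ (φ '' G) = ⊤ := by
    rw [eq_top_iff, ← (Pi.basisFun ℚ S).span_eq, Submodule.span_le]
    rintro _ ⟨χ, rfl⟩
    have h1 := Submodule.smul_mem _ ((n : ℚ)⁻¹) (hmem _ (single_nsmul_mem_latFin χ.2))
    suffices hs : Pi.basisFun ℚ S χ = (n : ℚ)⁻¹ • φ (Pi.single (χ : ZMod n) (n : ℤ)) by
      rw [hs]
      exact h1
    ext ψ
    by_cases hψ : ψ = χ
    · subst hψ
      simp [φ, hn]
    · have : (ψ : ZMod n) ≠ χ := fun h => hψ (Subtype.ext h)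
      simp [φ, Pi.single_eq_of_ne hψ, Pi.single_eq_of_ne this]
  obtain ⟨b, hbG, hspan, hli⟩ := exists_linearIndependent ℚ (φ '' G)
  let B : Module.Basis b ℚ (S → ℚ) := Module.Basis.mk hli (by
    rw [Subtype.range_coe, hspan, htop])
  have : Fintype b := FiniteDimensional.fintypeBasisIndex B
  have hcard : Fintype.card b = S.card := by
    rw [← Module.finrank_eq_card_basis B]; simp
  let e : Fin S.card ≃ b := (Fintype.equivFinOfCardEq hcard).symm
  choose g hgG hg using fun x : b => hbG x.2
  refine ⟨g ∘ e, fun j => (hgG _).1, ?_, fun j => (hgG _).2.1, fun j => (hgG _).2.2⟩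
  have hφ : LinearIndependent ℤ (φ ∘ g) := by
    have : φ ∘ g = ((↑) : b → S → ℚ) := funext hg
    rw [this]
    exact hli.restrict_scalars (fun x y hxy => by simpa using hxy)
  exact (LinearIndependent.of_comp φ hφ).comp _ e.injective

lemma mem_Sm {n m : ℕ} {χ : ZMod n} :
    χ ∈ Sm n m ↔ (∃ j : ℕ, 1 ≤ j ∧ j ≤ (m + 1) / 2 ∧ χ = j) ∨
      ∃ j : ℕ, 1 ≤ j ∧ j ≤ m / 2 ∧ χ = -(j : ZMod n) := by
  unfold Sm
  split_ifs with h
  · have : (m + 1) / 2 = m / 2 := by omega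
    simp [this, and_assoc, eq_comm]
  · have h1 : (m - 1) / 2 = m / 2 := by omega
    have h2 : (m + 1) / 2 = m / 2 + 1 := by omega
    rw [h1, h2]
    simp only [Finset.mem_union, Finset.mem_image, Finset.mem_Icc, Finset.mem_singleton]
    constructor
    · rintro ((⟨j, hj, rfl⟩ | ⟨j, hj, rfl⟩) | rfl)
      · exact Or.inl ⟨j, hj.1, by omega, rfl⟩
      · exact Or.inr ⟨j, hj.1, hj.2, rfl⟩
      · exact Or.inl ⟨_, by omega, le_rfl, rfl⟩
    · rintro (⟨j, hj, hj', rfl⟩ | ⟨j, hj, hj', rfl⟩)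
      · rcases Nat.lt_or_ge j (m / 2 + 1) with hlt | hge
        · exact Or.inl (Or.inl ⟨j, ⟨hj, by omega⟩, rfl⟩)
        · exact Or.inr (by rw [le_antisymm hj' hge])
      · exact Or.inl (Or.inr ⟨j, ⟨hj, hj'⟩, rfl⟩)

lemma natCast_ne_zero_of_lt {n j : ℕ} (h1 : 1 ≤ j) (h2 : j < n) : (j : ZMod n) ≠ 0 := by
  rw [Ne, ZMod.natCast_eq_zero_iff]
  exact Nat.not_dvd_of_pos_of_lt h1 h2

/-- If all of `S` is represented by integers of absolute value at most `k`, the full-rank degree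
is at least `n / k`. -/
lemma le_mul_of_frLE {n k d : ℕ} {S : Finset (ZMod n)} {c : ZMod n} (hc : c ∈ S) (hc0 : c ≠ 0)
    (hS : ∀ χ ∈ S, ∃ w : ℤ, (w : ZMod n) = χ ∧ |w| ≤ k) (h : frLE S d) : n ≤ d * k := by
  by_contra! hlt
  have hS' : ∀ χ : ZMod n, ∃ w : ℤ, χ ∈ S → (w : ZMod n) = χ ∧ |w| ≤ k := fun χ => by
    by_cases hχ : χ ∈ S
    · exact (hS χ hχ).imp fun w hw _ => hw
    · exact ⟨0, fun h => absurd h hχ⟩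
  choose w hw using hS'
  refine not_frLE_of_orthogonal w c hc (fun h0 => hc0 ?_) ?_ h
  · rw [← (hw c hc).1, h0, Int.cast_zero]
  · intro a ha hnn hdeg
    refine Int.eq_zero_of_abs_lt_dvd (m := n) ?_ ?_
    · rw [← ZMod.intCast_zmod_eq_zero_iff_dvd, Int.cast_sum]
      rw [← ha.2]
      exact Finset.sum_congr rfl fun χ hχ => by simp [(hw χ hχ).1]
    · calc |∑ χ ∈ S, a χ * w χ| ≤ ∑ χ ∈ S, |a χ * w χ| := Finset.abs_sum_le_sum_abs _ _
        _ ≤ ∑ χ ∈ S, a χ * k := Finset.sum_le_sum fun χ hχ => by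
            rw [abs_mul, abs_of_nonneg (hnn χ)]
            exact mul_le_mul_of_nonneg_left (hw χ hχ).2 (hnn χ)
        _ = (∑ χ ∈ S, a χ) * k := (Finset.sum_mul _ _ _).symm
        _ ≤ d * k := mul_le_mul_of_nonneg_right hdeg (by positivity)
        _ < n := by exact_mod_cast hlt

/-- Nonnegative elements of `L(S)` of degree at most two are symmetric. -/
lemma latFin_apply_neg {n : ℕ} {S : Finset (ZMod n)} {a : ZMod n → ℤ} (ha : a ∈ latFin S)
    (hnn : ∀ χ, 0 ≤ a χ) (hdeg : ∑ χ ∈ S, a χ ≤ 2) {c : ZMod n} (hc0 : c ≠ 0)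
    (hcn : -c ≠ c) (hpos : a c ≠ 0) : a (-c) = a c := by
  classical
  have hc : c ∈ S := by
    by_contra h
    exact hpos (ha.1 c h)
  have hac : 1 ≤ a c := by have := hnn c; omega
  set b : ZMod n → ℤ := a - Pi.single c 1 with hb
  have hbc : b c = a c - 1 := by simp [hb]
  have hbne : ∀ χ, χ ≠ c → b χ = a χ := fun χ h => by simp [hb, Pi.single_eq_of_ne h]
  have hbnn : ∀ χ, 0 ≤ b χ := fun χ => by
    by_cases h : χ = c
    · subst h; omega
    · rw [hbne χ h]; exact hnn χ
  have hbdeg : ∑ χ ∈ S, b χ ≤ 1 := by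
    have : ∑ χ ∈ S, b χ = ∑ χ ∈ S, a χ - 1 := by simp [hb, hc]
    omega
  have hbsum : ∑ χ ∈ S, b χ • χ = -c := by
    have h1 : ∑ χ ∈ S, (Pi.single c (1 : ℤ) : ZMod n → ℤ) χ • χ = c := by
      rw [Finset.sum_eq_single_of_mem c hc]
      · simp
      · intro x _ hx
        simp [Pi.single_eq_of_ne hx]
    have h2 : ∑ χ ∈ S, b χ • χ
        = ∑ χ ∈ S, a χ • χ - ∑ χ ∈ S, (Pi.single c (1 : ℤ) : ZMod n → ℤ) χ • χ := by
      rw [← Finset.sum_sub_distrib]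
      exact Finset.sum_congr rfl fun χ _ => by rw [hb, Pi.sub_apply, sub_smul]
    rw [h2, h1, ha.2, zero_sub]
  obtain ⟨x, hx, hbx⟩ : ∃ x ∈ S, b x ≠ 0 := by
    by_contra! hall
    rw [Finset.sum_eq_zero fun χ hχ => by rw [hall χ hχ, zero_smul]] at hbsum
    exact hc0 (neg_eq_zero.1 hbsum.symm)
  have hsplit := Finset.add_sum_erase S b hx
  have hrest : 0 ≤ ∑ χ ∈ S.erase x, b χ := Finset.sum_nonneg fun χ _ => hbnn χ
  have hbx1 : b x = 1 := by have := hbnn x; omega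
  have hzero : ∀ χ ∈ S.erase x, b χ = 0 :=
    (Finset.sum_eq_zero_iff_of_nonneg fun χ _ => hbnn χ).1 (by omega)
  have hxc : x = -c := by
    rw [← Finset.add_sum_erase S _ hx, hbx1, one_smul,
      Finset.sum_eq_zero fun χ hχ => by rw [hzero χ hχ, zero_smul], add_zero] at hbsum
    exact hbsum
  have h3 : b c = 0 := hzero c (Finset.mem_erase.2 ⟨fun h => hcn (by rw [← hxc, h]), hc⟩)
  rw [← hbne _ hcn, ← hxc, hbx1]
  omega

lemma three_le_of_frLE {n d : ℕ} {S : Finset (ZMod n)} {c : ZMod n} (hc : c ∈ S) (hc0 : c ≠ 0)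
    (hcn : -c ≠ c) (h : frLE S d) : 3 ≤ d := by
  classical
  by_contra! hlt
  refine not_frLE_of_orthogonal (Pi.single c 1 - Pi.single (-c) 1) c hc ?_ ?_ h
  · simp [Pi.single_eq_of_ne hcn.symm]
  · intro a ha hnn hdeg
    have hdeg2 : ∑ χ ∈ S, a χ ≤ 2 := hdeg.trans (by exact_mod_cast Nat.le_of_lt_succ hlt)
    have hsymm : a (-c) = a c := by
      by_cases h1 : a c = 0
      · by_cases h2 : a (-c) = 0
        · rw [h1, h2]
        · have := latFin_apply_neg ha hnn hdeg2 (neg_ne_zero.2 hc0)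
            (by rw [neg_neg]; exact hcn.symm) h2
          rw [neg_neg] at this
          exact this.symm
      · exact latFin_apply_neg ha hnn hdeg2 hc0 hcn h1
    have hneg : -c ∉ S → a (-c) = 0 := ha.1 _
    simp only [Pi.sub_apply, mul_sub, Finset.sum_sub_distrib, Pi.single_apply, mul_ite, mul_one,
      mul_zero, Finset.sum_ite_eq', hc, if_true]
    split_ifs with h1
    · rw [hsymm, sub_self]
    · rw [← hsymm, hneg h1, sub_zero]

/-- If every `e_χ` is congruent to a multiple of `e_1` modulo a subgroup containing `n e_1`, then
the subgroup contains `L(S)`. -/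
lemma latFin_le_of_congr {n : ℕ} {S : Finset (ZMod n)} (H : AddSubgroup (ZMod n → ℤ))
    (hH : ∀ χ ∈ S, ∃ w : ℤ, (w : ZMod n) = χ ∧
      Pi.single χ 1 - w • Pi.single (1 : ZMod n) (1 : ℤ) ∈ H)
    (hn : (n : ℤ) • Pi.single (1 : ZMod n) (1 : ℤ) ∈ H) : latFin S ≤ H := by
  classical
  intro a ha
  have hH' : ∀ χ : ZMod n, ∃ w : ℤ, χ ∈ S → (w : ZMod n) = χ ∧
      Pi.single χ 1 - w • Pi.single (1 : ZMod n) (1 : ℤ) ∈ H := fun χ => by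
    by_cases hχ : χ ∈ S
    · exact (hH χ hχ).imp fun w hw _ => hw
    · exact ⟨0, fun h => absurd h hχ⟩
  choose w hw using hH'
  obtain ⟨q, hq⟩ : (n : ℤ) ∣ ∑ χ ∈ S, a χ * w χ := by
    rw [← ZMod.intCast_zmod_eq_zero_iff_dvd, Int.cast_sum, ← ha.2]
    exact Finset.sum_congr rfl fun χ hχ => by simp [(hw χ hχ).1]
  have hsum : a = ∑ χ ∈ S, a χ • (Pi.single χ 1 : ZMod n → ℤ) := by
    ext ψ
    by_cases hψ : ψ ∈ S
    · simp [Finset.sum_apply, Pi.single_apply, hψ]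
    · simp [Finset.sum_apply, Pi.single_apply, hψ, ha.1 ψ hψ]
  have key : a = ∑ χ ∈ S, a χ • (Pi.single χ 1 - w χ • Pi.single (1 : ZMod n) (1 : ℤ))
      + q • ((n : ℤ) • Pi.single (1 : ZMod n) (1 : ℤ)) := by
    conv_lhs => rw [hsum]
    simp only [smul_sub, Finset.sum_sub_distrib, smul_smul, ← Finset.sum_smul]
    rw [hq, mul_comm q, sub_add_cancel]
  rw [key]
  exact add_mem (sum_mem fun χ hχ => H.zsmul_mem (hw χ hχ).2 _) (H.zsmul_mem hn _)


/-- Short zero-sum sequences over `S` lie in the subgroup generated in degree `≤ d`. -/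
lemma sum_single_mem_closure {n d : ℕ} {S : Finset (ZMod n)} (l : List (ZMod n))
    (hl : ∀ x ∈ l, x ∈ S) (hsum : l.sum = 0) (hlen : l.length ≤ d) :
    (l.map fun x => (Pi.single x 1 : ZMod n → ℤ)).sum ∈ AddSubgroup.closure
      {a | a ∈ latFin S ∧ (∀ χ, 0 ≤ a χ) ∧ ∑ χ ∈ S, a χ ≤ (d : ℤ)} := by
  classical
  have key : ∀ l : List (ZMod n), (∀ x ∈ l, x ∈ S) →
      (∀ χ ∉ S, (l.map fun x => (Pi.single x 1 : ZMod n → ℤ)).sum χ = 0) ∧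
      (∀ χ, 0 ≤ (l.map fun x => (Pi.single x 1 : ZMod n → ℤ)).sum χ) ∧
      ∑ χ ∈ S, (l.map fun x => (Pi.single x 1 : ZMod n → ℤ)).sum χ = l.length ∧
      ∑ χ ∈ S, (l.map fun x => (Pi.single x 1 : ZMod n → ℤ)).sum χ • χ = l.sum := by
    intro l hl
    induction l with
    | nil => simp
    | cons x l ih =>
      obtain ⟨h1, h2, h3, h4⟩ := ih fun y hy => hl y (List.mem_cons_of_mem _ hy)
      have hx : x ∈ S := hl x List.mem_cons_self
      simp only [List.map_cons, List.sum_cons, Pi.add_apply, add_smul, Finset.sum_add_distrib,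
        List.length_cons, h3, h4, Pi.single_apply]
      refine ⟨fun χ hχ => ?_, fun χ => ?_, ?_, ?_⟩
      · rw [h1 χ hχ, if_neg (ne_of_mem_of_not_mem hx hχ).symm, add_zero]
      · have := h2 χ
        split_ifs <;> omega
      · simp [hx, add_comm]
      · simp [ite_smul, hx]
  obtain ⟨h1, h2, h3, h4⟩ := key l hl
  exact AddSubgroup.subset_closure ⟨⟨h1, h4.trans hsum⟩, h2, by rw [h3]; exact_mod_cast hlen⟩

lemma genLE_Sm {n m d : ℕ} (hm1 : 1 ≤ m) (h3 : 3 ≤ d) (hd : cdiv n ((m + 1) / 2) ≤ d) :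
    genLE (Sm n m) d := by
  unfold genLE
  set H := AddSubgroup.closure
    {a | a ∈ latFin (Sm n m) ∧ (∀ χ, 0 ≤ a χ) ∧ ∑ χ ∈ Sm n m, a χ ≤ (d : ℤ)}
  let e : ZMod n → ZMod n → ℤ := fun χ => Pi.single χ 1
  set k := (m + 1) / 2 with hk
  have hk1 : 1 ≤ k := by omega
  have memP : ∀ j : ℕ, 1 ≤ j → j ≤ k → (j : ZMod n) ∈ Sm n m := fun j h1 h2 =>
    mem_Sm.2 (Or.inl ⟨j, h1, h2, rfl⟩)
  have memN : ∀ j : ℕ, 1 ≤ j → j ≤ m / 2 → -(j : ZMod n) ∈ Sm n m := fun j h1 h2 =>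
    mem_Sm.2 (Or.inr ⟨j, h1, h2, rfl⟩)
  have pair : ∀ j : ℕ, 1 ≤ j → j ≤ m / 2 → e j + e (-(j : ZMod n)) ∈ H := by
    intro j h1 h2
    have := sum_single_mem_closure (d := d) (S := Sm n m) [(j : ZMod n), -(j : ZMod n)]
      (by simp [memP j h1 (by omega), memN j h1 h2]) (by simp) (by simp; omega)
    simpa using this
  have pos : ∀ j : ℕ, 1 ≤ j → j ≤ k → e j - (j : ℤ) • e 1 ∈ H := by
    intro j h1
    induction j, h1 using Nat.le_induction with
    | base => intro _; simp
    | succ j h1 ih =>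
      intro h2
      have htriple := sum_single_mem_closure (d := d) (S := Sm n m)
        [((j + 1 : ℕ) : ZMod n), -(j : ZMod n), -((1 : ℕ) : ZMod n)]
        (by
          have := memP (j + 1) (by omega) h2
          have := memN j h1 (by omega)
          have := memN 1 le_rfl (by omega)
          simp_all)
        (by push_cast; simp only [List.sum_cons, List.sum_nil]; ring) (by simpa using h3)
      have hj := pair j h1 (by omega)
      have h1' := pair 1 le_rfl (by omega)
      have : e ((j + 1 : ℕ) : ZMod n) - ((j + 1 : ℕ) : ℤ) • e 1
          = (e ((j + 1 : ℕ) : ZMod n) + (e (-(j : ZMod n)) + e (-((1 : ℕ) : ZMod n))))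
            - (e j + e (-(j : ZMod n))) - (e (1 : ℕ) + e (-((1 : ℕ) : ZMod n)))
            + (e j - (j : ℤ) • e 1) := by
        rw [Nat.cast_one (R := ZMod n), Nat.cast_succ (R := ℤ), add_smul, one_smul]
        abel
      rw [this]
      refine add_mem (sub_mem (sub_mem ?_ hj) h1') (ih (by omega))
      simpa using htriple
  refine le_antisymm ((AddSubgroup.closure_le _).2 fun a ha => ha.1) ?_
  refine latFin_le_of_congr H ?_ ?_
  · intro χ hχ
    rcases mem_Sm.1 hχ with ⟨j, h1, h2, rfl⟩ | ⟨j, h1, h2, rfl⟩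
    · exact ⟨j, by simp, pos j h1 h2⟩
    · refine ⟨-j, by simp, ?_⟩
      have := sub_mem (pair j h1 h2) (pos j h1 (by omega))
      convert this using 1
      simp only [e, neg_smul]
      abel
  · have hdm := Nat.div_add_mod n k
    have hr : n % k < k := Nat.mod_lt _ hk1
    set q := n / k
    set r := n % k
    have hnk : (n : ZMod n) = 0 := ZMod.natCast_self n
    have hqk : (q : ℤ) • (e k - (k : ℤ) • e 1) ∈ H := H.zsmul_mem (pos k hk1 le_rfl) _
    have hqd : q + (if r = 0 then 0 else 1) ≤ d := by
      refine le_trans ?_ hd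
      unfold cdiv
      rw [Nat.le_div_iff_mul_le hk1, add_mul, mul_comm q]
      split_ifs <;> omega
    by_cases hr0 : r = 0
    · have := sum_single_mem_closure (d := d) (S := Sm n m) (List.replicate q (k : ZMod n))
        (fun x hx => by rw [List.eq_of_mem_replicate hx]; exact memP k hk1 le_rfl)
        (by
          rw [List.sum_replicate, nsmul_eq_mul, ← Nat.cast_mul, mul_comm, ← hnk, ← hdm, hr0,
            add_zero])
        (by simpa [hr0] using hqd)
      have h2 := sub_mem this hqk
      convert h2 using 1
      rw [List.map_replicate, List.sum_replicate, smul_sub, smul_smul, natCast_zsmul _ q,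
        sub_sub_cancel]
      congr 1
      exact_mod_cast (by rw [mul_comm]; omega : n = q * k)
    · have := sum_single_mem_closure (d := d) (S := Sm n m)
        ((r : ZMod n) :: List.replicate q (k : ZMod n))
        (fun x hx => by
          rcases List.mem_cons.1 hx with rfl | hx
          · exact memP r (by omega) hr.le
          · rw [List.eq_of_mem_replicate hx]; exact memP k hk1 le_rfl)
        (by
          rw [List.sum_cons, List.sum_replicate, nsmul_eq_mul, ← Nat.cast_mul, ← Nat.cast_add,
            mul_comm, add_comm, hdm, hnk])
        (by simpa [hr0] using hqd)
      have h2 := sub_mem (sub_mem this hqk) (pos r (by omega) hr.le)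
      convert h2 using 1
      rw [List.map_cons, List.sum_cons, List.map_replicate, List.sum_replicate, smul_sub, smul_smul,
        natCast_zsmul _ q]
      have : (n : ℤ) = q * k + r := by exact_mod_cast (by rw [mul_comm]; omega : n = q * k + r)
      rw [this, add_smul]
      simp only [e]
      abel

/-- Let `n ≥ 3` and `1 ≤ m < n`. Then both the generation degree and the
full-rank degree of the lattice `L(S_m)` equal `max 3 ⌈n / ⌈m/2⌉⌉`. -/
theorem stmt_15 (n m : ℕ) (hn : 3 ≤ n) (hm1 : 1 ≤ m) (hmn : m < n) :
    sInf {d : ℕ | genLE (Sm n m) d} = max 3 (cdiv n ((m + 1) / 2)) ∧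
      sInf {d : ℕ | frLE (Sm n m) d} = max 3 (cdiv n ((m + 1) / 2)) := by
  have hgen : genLE (Sm n m) (max 3 (cdiv n ((m + 1) / 2))) :=
    genLE_Sm hm1 (le_max_left _ _) (le_max_right _ _)
  have hone : (1 : ZMod n) ∈ Sm n m := mem_Sm.2 (Or.inl ⟨1, le_rfl, by omega, by simp⟩)
  have hone0 : (1 : ZMod n) ≠ 0 := by
    simpa using natCast_ne_zero_of_lt le_rfl (by omega : 1 < n)
  have hone2 : (-1 : ZMod n) ≠ 1 := by
    intro h
    refine natCast_ne_zero_of_lt (by omega : 1 ≤ 2) (by omega : 2 < n) ?_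
    rw [neg_eq_iff_add_eq_zero] at h
    rw [← h]
    norm_num
  have hlow : ∀ d, frLE (Sm n m) d → max 3 (cdiv n ((m + 1) / 2)) ≤ d := by
    intro d hd
    refine max_le (three_le_of_frLE hone hone0 hone2 hd) ?_
    have hnk : n ≤ d * ((m + 1) / 2) := by
      refine le_mul_of_frLE hone hone0 (fun χ hχ => ?_) hd
      rcases mem_Sm.1 hχ with ⟨j, -, h2, rfl⟩ | ⟨j, -, h2, rfl⟩
      · exact ⟨j, by simp, by rw [Nat.abs_cast]; exact_mod_cast h2⟩
      · exact ⟨-j, by simp, by rw [abs_neg, Nat.abs_cast]; exact_mod_cast (by omega)⟩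
    unfold cdiv
    refine Nat.lt_succ_iff.1 ((Nat.div_lt_iff_lt_mul (by omega)).2 ?_)
    rw [Nat.succ_mul]
    omega
  have hn0 : n ≠ 0 := by omega
  exact ⟨IsLeast.csInf_eq ⟨hgen, fun d hd => hlow d (hd.frLE hn0)⟩,
    IsLeast.csInf_eq ⟨hgen.frLE hn0, fun d hd => hlow d hd⟩⟩
end

section
/- Let G be a finite group, k a field, N ∈ ℕ, and χ : Fin N → (G →* kˣ) a family of characters of G. Suppose G acts on R := MvPolynomial (Fin N) k by a multiplicative semiring action such that g • C(c) = C(c) for all g ∈ G and c ∈ k, and g • Xᵢ = C(χᵢ(g)) · Xᵢ for all g and i; and suppose G acts on F := FractionRing R by a multiplicative semiring action making the canonical algebra map R → F equivariant. Let L := {a : Fin N → ℤ | for every g ∈ G, Π_i χᵢ(g)^{a(i)} = 1 in kˣ}. Then for every d ∈ ℕ, the following are equivalent: (1) the subfield of F generated by the image of k together with the images of all G-invariant polynomials in R of total degree ≤ d equals the fixed subfield F^G; (2) L is generated, as an additive group, by its elements a with a(i) ≥ 0 for all i and Σ_i a(i) ≤ d. (This is the paper's key equivalence: β_field(G,V)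 equals the generation degree of the lattice L(G,V).) -/
set_option synthInstance.maxHeartbeats 1000000
set_option maxHeartbeats 1000000
open MvPolynomial

/-- The subring of polynomials all of whose exponent vectors lie in `M`. -/
def expSupported {σ : Type*} (k : Type*) [Field k] (M : AddSubgroup (σ → ℤ)) :
    Subring (MvPolynomial σ k) where
  carrier := {p | ∀ m, coeff m p ≠ 0 → (fun i => (m i : ℤ)) ∈ M}
  zero_mem' := by intro m hm; simp at hm
  one_mem' := by
    classical
    intro m hm
    rw [coeff_one] at hm
    obtain rfl : 0 = m := by by_contra h; simp [h] at hm
    exact M.zero_mem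
  add_mem' := by
    intro p q hp hq m hm
    by_cases h : coeff m p = 0
    · exact hq m fun h' => hm (by rw [coeff_add, h, h', add_zero])
    · exact hp m h
  neg_mem' := by
    intro p hp m hm
    exact hp m fun h => hm (by rw [coeff_neg, h, neg_zero])
  mul_mem' := by
    classical
    intro p q hp hq m hm
    rw [coeff_mul] at hm
    obtain ⟨⟨u, v⟩, huv, hne⟩ := Finset.exists_ne_zero_of_sum_ne_zero hm
    rw [Finset.HasAntidiagonal.mem_antidiagonal] at huv
    subst huv
    have := M.add_mem (hp u (left_ne_zero_of_mul hne)) (hq v (right_ne_zero_of_mul hne))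
    convert this using 1
    ext i
    simp

/-- The Laurent monomial with exponent vector `a`, in a field over the polynomial ring. -/
noncomputable def laurentMonomial {σ k : Type*} [Fintype σ] [Field k] (F : Type*) [Field F]
    [Algebra (MvPolynomial σ k) F] (a : σ → ℤ) : F :=
  ∏ i, algebraMap (MvPolynomial σ k) F (X i) ^ a i

lemma algebraMap_X_ne_zero {σ k F : Type*} [Field k] [Field F] [Algebra (MvPolynomial σ k) F]
    [IsFractionRing (MvPolynomial σ k) F] (i : σ) :
    algebraMap (MvPolynomial σ k) F (X i) ≠ 0 := by
  rw [Ne, IsFractionRing.to_map_eq_zero_iff]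
  exact X_ne_zero i

section laurentMonomial

variable {σ k F : Type*} [Fintype σ] [Field k] [Field F] [Algebra (MvPolynomial σ k) F]

lemma algebraMap_monomial_one (m : σ →₀ ℕ) :
    algebraMap (MvPolynomial σ k) F (monomial m 1) =
      laurentMonomial (k := k) F fun i => (m i : ℤ) := by
  rw [monomial_eq, Finsupp.prod_fintype _ _ fun _ => pow_zero _]
  simp [laurentMonomial]

lemma laurentMonomial_zero : laurentMonomial (k := k) F (0 : σ → ℤ) = 1 := by
  simp [laurentMonomial]

lemma laurentMonomial_neg (a : σ → ℤ) :
    laurentMonomial (k := k) F (-a) = (laurentMonomial (k := k) F a)⁻¹ := by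
  simp [laurentMonomial]

variable [IsFractionRing (MvPolynomial σ k) F]

lemma laurentMonomial_add (a b : σ → ℤ) :
    laurentMonomial (k := k) F (a + b) =
      laurentMonomial (k := k) F a * laurentMonomial (k := k) F b := by
  simp only [laurentMonomial, ← Finset.prod_mul_distrib, Pi.add_apply]
  exact Finset.prod_congr rfl fun i _ => zpow_add₀ (algebraMap_X_ne_zero i) _ _

/-- A Laurent monomial that is a quotient of polynomials with exponents in `M` has its exponent
vector in `M`. -/
lemma mem_of_laurentMonomial_eq_div {M : AddSubgroup (σ → ℤ)} {a : σ → ℤ}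
    {p q : MvPolynomial σ k} (hp : p ∈ expSupported k M) (hq : q ∈ expSupported k M)
    (hq0 : q ≠ 0) (h : laurentMonomial (k := k) F a =
      algebraMap (MvPolynomial σ k) F p / algebraMap (MvPolynomial σ k) F q) : a ∈ M := by
  let u : σ →₀ ℕ := Finsupp.equivFunOnFinite.symm fun i => (a i).toNat
  let v : σ →₀ ℕ := Finsupp.equivFunOnFinite.symm fun i => (-a i).toNat
  have huv (i : σ) : a i + (v i : ℤ) = u i := by
    simp only [u, v, Finsupp.equivFunOnFinite_symm_apply_apply]
    omega
  have hqF : algebraMap (MvPolynomial σ k) F q ≠ 0 := by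
    rwa [Ne, IsFractionRing.to_map_eq_zero_iff]
  have hmul : monomial u 1 * q = monomial v 1 * p := by
    apply IsFractionRing.injective (MvPolynomial σ k) F
    rw [map_mul, map_mul, algebraMap_monomial_one, algebraMap_monomial_one,
      (div_eq_iff hqF).1 h.symm, ← mul_assoc, ← laurentMonomial_add]
    congr 2
    ext i
    simp [← huv i, add_comm]
  obtain ⟨m, hm⟩ := ne_zero_iff.1 hq0
  have hc : coeff (u + m) (monomial v 1 * p) = coeff m q := by
    rw [← hmul, coeff_monomial_mul, one_mul]
  rw [coeff_monomial_mul', one_mul] at hc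
  split_ifs at hc with hle
  · have hw := hp (u + m - v) (by rwa [hc])
    have := M.sub_mem hw (hq m hm)
    convert this using 1
    ext i
    have hi := hle i
    have := huv i
    simp only [Pi.sub_apply, Finsupp.coe_add, Finsupp.coe_tsub, Pi.add_apply] at hi ⊢
    omega
  · exact absurd hc.symm hm

end laurentMonomial

section diagonalAction

variable {G σ k : Type*} [Group G] [Fintype σ] [Field k] {χ : σ → (G →* kˣ)}
  [MulSemiringAction G (MvPolynomial σ k)]

lemma coeff_smul_of_diagonal
    (hC : ∀ (g : G) (c : k), g • (C c : MvPolynomial σ k) = C c)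
    (hX : ∀ (g : G) (i : σ), g • (X i : MvPolynomial σ k) = C ((χ i g : kˣ) : k) * X i)
    (g : G) (f : MvPolynomial σ k) (m : σ →₀ ℕ) :
    coeff m (g • f) = ((∏ i, χ i g ^ (m i : ℤ) : kˣ) : k) * coeff m f := by
  classical
  induction f using MvPolynomial.induction_on' with
  | monomial u c =>
    have : g • monomial u c = C ((∏ i, χ i g ^ (u i : ℤ) : kˣ) : k) * monomial u c := by
      rw [monomial_eq, Finsupp.prod_fintype _ _ fun _ => pow_zero _, smul_mul', hC,
        Finset.smul_prod']
      simp only [smul_pow', hX, mul_pow, Finset.prod_mul_distrib, zpow_natCast,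
        Units.coe_prod, Units.val_pow_eq_pow_val, map_prod, map_pow]
      ring
    rw [this, coeff_C_mul, coeff_monomial]
    split_ifs with h
    · rw [h]
    · simp
  | add p q hp hq => rw [smul_add, coeff_add, hp, hq, coeff_add, mul_add]

lemma forall_smul_eq_iff_mem_expSupported
    (hC : ∀ (g : G) (c : k), g • (C c : MvPolynomial σ k) = C c)
    (hX : ∀ (g : G) (i : σ), g • (X i : MvPolynomial σ k) = C ((χ i g : kˣ) : k) * X i)
    {L : AddSubgroup (σ → ℤ)} (hL : ∀ a : σ → ℤ, a ∈ L ↔ ∀ g : G, ∏ i, (χ i g) ^ (a i) = 1)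
    (f : MvPolynomial σ k) : (∀ g : G, g • f = f) ↔ f ∈ expSupported k L := by
  constructor
  · intro h m hm
    rw [hL]
    intro g
    have := coeff_smul_of_diagonal hC hX g f m
    rw [h g, eq_comm, mul_eq_right₀ hm] at this
    exact Units.ext this
  · intro h g
    ext m
    rw [coeff_smul_of_diagonal hC hX]
    by_cases hm : coeff m f = 0
    · simp [hm]
    · rw [(hL _).1 (h m hm) g, Units.val_one, one_mul]

/-- Polynomials with exponents in `M` lie in any subfield containing the constants and the
Laurent monomials with exponents in `M`. -/
lemma algebraMap_mem_of_mem_expSupported {F : Type*} [Field F] [Algebra (MvPolynomial σ k) F]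
    {M : AddSubgroup (σ → ℤ)} {K : Subfield F}
    (hK : ∀ c : k, algebraMap (MvPolynomial σ k) F (C c) ∈ K)
    (hM : ∀ a ∈ M, laurentMonomial (k := k) F a ∈ K)
    {f : MvPolynomial σ k} (hf : f ∈ expSupported k M) :
    algebraMap (MvPolynomial σ k) F f ∈ K := by
  rw [f.as_sum, map_sum]
  refine K.sum_mem fun m hm => ?_
  rw [← mul_one (coeff m f), ← C_mul_monomial, map_mul, algebraMap_monomial_one]
  exact K.mul_mem (hK _) (hM _ (hf m (mem_support_iff.1 hm)))

lemma smul_laurentMonomial {F : Type*} [Field F] [Algebra (MvPolynomial σ k) F]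
    [MulSemiringAction G F]
    (hX : ∀ (g : G) (i : σ), g • (X i : MvPolynomial σ k) = C ((χ i g : kˣ) : k) * X i)
    (hcompat : ∀ (g : G) (f : MvPolynomial σ k),
      g • algebraMap (MvPolynomial σ k) F f = algebraMap (MvPolynomial σ k) F (g • f))
    (g : G) (a : σ → ℤ) :
    g • laurentMonomial (k := k) F a =
      algebraMap (MvPolynomial σ k) F (C ((∏ i, χ i g ^ a i : kˣ) : k)) *
        laurentMonomial (k := k) F a := by
  change MulSemiringAction.toRingHom G F g _ = _
  simp only [laurentMonomial, map_prod, map_zpow₀, MulSemiringAction.toRingHom_apply,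
    hcompat, hX, map_mul, mul_zpow, Finset.prod_mul_distrib, Units.coe_prod]
  congr 1
  refine Finset.prod_congr rfl fun i _ => ?_
  rw [Units.val_zpow_eq_zpow_val]
  exact (map_zpow₀ ((algebraMap (MvPolynomial σ k) F).comp C) _ _).symm

end diagonalAction

/-- A fixed element of the fraction field is a quotient of invariants. -/
lemma exists_invariant_div_eq {G R F : Type*} [Group G] [Finite G] [CommRing R] [IsDomain R]
    [Field F] [Algebra R F] [IsFractionRing R F] [MulSemiringAction G R] [MulSemiringAction G F]
    (hcompat : ∀ (g : G) (r : R), g • algebraMap R F r = algebraMap R F (g • r))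
    {x : F} (hx : ∀ g : G, g • x = x) :
    ∃ p q : R, (∀ g : G, g • p = p) ∧ (∀ g : G, g • q = q) ∧
      algebraMap R F p / algebraMap R F q = x := by
  cases nonempty_fintype G
  obtain ⟨r, s, hs, rfl⟩ := IsFractionRing.div_surjective (A := R) x
  have hs0 : s ≠ 0 := nonZeroDivisors.ne_zero hs
  let q : R := ∏ g : G, g • s
  have hq (g : G) : g • q = q := by
    simp only [q, Finset.smul_prod', ← mul_smul]
    exact Fintype.prod_equiv (Equiv.mulLeft g) _ _ fun _ => rfl
  have hq0 : q ≠ 0 := Finset.prod_ne_zero_iff.2 fun g _ => (smul_ne_zero_iff_ne g).2 hs0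
  obtain ⟨t, ht⟩ : s ∣ q := by
    simpa using Finset.dvd_prod_of_mem (fun g : G => g • s) (Finset.mem_univ 1)
  have hsF : algebraMap R F s ≠ 0 := by rwa [Ne, IsFractionRing.to_map_eq_zero_iff]
  have hqF : algebraMap R F q ≠ 0 := by rwa [Ne, IsFractionRing.to_map_eq_zero_iff]
  have key : algebraMap R F (r * t) =
      algebraMap R F r / algebraMap R F s * algebraMap R F q := by
    rw [ht, map_mul, map_mul]
    field_simp
  refine ⟨r * t, q, fun g => ?_, hq, ?_⟩
  · apply IsFractionRing.injective R F
    rw [← hcompat, key, smul_mul', hx, hcompat, hq]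
  · rw [key, mul_div_cancel_right₀ _ hqF]

/-- Let `G` be a finite group acting diagonally on `k[X₁,…,X_N]` through
characters `χᵢ : G →* kˣ` (so `g • C c = C c` and `g • Xᵢ = C (χᵢ g) * Xᵢ`), with a compatible
action on the fraction field `F`. Let `L = {a : Fin N → ℤ | ∀ g, ∏ i, χᵢ(g)^{a i} = 1}`.
Then for every `d`: the subfield of `F` generated by the image of `k` and the images of the
`G`-invariant polynomials of total degree `≤ d` equals the fixed field `F^G` if and only if
`L` is generated, as an additive group, by its nonnegative elements of degree `≤ d`. -/
theorem stmt_19 (G : Type*) [Group G] [Finite G] (k : Type*) [Field k] (N : ℕ)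
    (χ : Fin N → (G →* kˣ))
    [MulSemiringAction G (MvPolynomial (Fin N) k)]
    [MulSemiringAction G (FractionRing (MvPolynomial (Fin N) k))]
    (hC : ∀ (g : G) (c : k), g • (C c : MvPolynomial (Fin N) k) = C c)
    (hX : ∀ (g : G) (i : Fin N),
        g • (X i : MvPolynomial (Fin N) k) = C ((χ i g : kˣ) : k) * X i)
    (hcompat : ∀ (g : G) (f : MvPolynomial (Fin N) k),
        g • (algebraMap (MvPolynomial (Fin N) k)
              (FractionRing (MvPolynomial (Fin N) k)) f) =
          algebraMap (MvPolynomial (Fin N) k) (FractionRing (MvPolynomial (Fin N) k)) (g • f))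
    (L : AddSubgroup (Fin N → ℤ))
    (hL : ∀ a : Fin N → ℤ, a ∈ L ↔ ∀ g : G, ∏ i, (χ i g) ^ (a i) = 1)
    (d : ℕ) :
    (Subfield.closure
        (Set.range ((algebraMap (MvPolynomial (Fin N) k)
            (FractionRing (MvPolynomial (Fin N) k))).comp (C : k →+* MvPolynomial (Fin N) k)) ∪
          (algebraMap (MvPolynomial (Fin N) k) (FractionRing (MvPolynomial (Fin N) k)) ''
            {f : MvPolynomial (Fin N) k | (∀ g : G, g • f = f) ∧ f.totalDegree ≤ d}))
        = FixedPoints.subfield G (FractionRing (MvPolynomial (Fin N) k))) ↔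
      AddSubgroup.closure {a | a ∈ L ∧ (∀ i, 0 ≤ a i) ∧ ∑ i, a i ≤ (d : ℤ)} = L := by
  classical
  set F := FractionRing (MvPolynomial (Fin N) k)
  set A := algebraMap (MvPolynomial (Fin N) k) F
  set S : Set (Fin N → ℤ) := {a | a ∈ L ∧ (∀ i, 0 ≤ a i) ∧ ∑ i, a i ≤ (d : ℤ)}
  have hinv := forall_smul_eq_iff_mem_expSupported hC hX hL
  constructor
  · intro h
    refine le_antisymm ((AddSubgroup.closure_le _).2 fun a ha => ha.1) fun a ha => ?_
    have hfix : laurentMonomial (k := k) F a ∈ FixedPoints.subfield G F := by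
      intro g
      rw [smul_laurentMonomial hX hcompat, (hL a).1 ha g, Units.val_one, C_1, map_one, one_mul]
    rw [← h, Subfield.mem_closure_iff] at hfix
    have hsub : Subring.closure (Set.range (A.comp C) ∪
        A '' {f : MvPolynomial (Fin N) k | (∀ g : G, g • f = f) ∧ f.totalDegree ≤ d}) ≤
        (expSupported k (AddSubgroup.closure S)).map A := by
      rw [Subring.closure_le]
      rintro _ (⟨c, rfl⟩ | ⟨f, ⟨hf, hd⟩, rfl⟩)
      · refine ⟨C c, fun m hm => ?_, rfl⟩
        rw [coeff_C] at hm
        obtain rfl : 0 = m := by by_contra h; simp [h] at hm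
        exact zero_mem _
      · refine ⟨f, fun m hm => AddSubgroup.subset_closure ⟨(hinv f).1 hf m hm, ?_, ?_⟩, rfl⟩
        · exact fun i => Int.natCast_nonneg _
        · have := (le_totalDegree (mem_support_iff.2 hm)).trans hd
          rw [Finsupp.sum_fintype _ _ fun _ => rfl] at this
          change ∑ i, (m i : ℤ) ≤ d
          exact_mod_cast this
    obtain ⟨y, hy, z, hz, hyz⟩ := hfix
    obtain ⟨p, hp, rfl⟩ := hsub hy
    obtain ⟨q, hq, rfl⟩ := hsub hz
    refine mem_of_laurentMonomial_eq_div hp hq ?_ hyz.symm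
    rintro rfl
    rw [map_zero, div_zero] at hyz
    exact Finset.prod_ne_zero_iff.2 (fun i _ => zpow_ne_zero _ (algebraMap_X_ne_zero i)) hyz.symm
  · intro h
    apply le_antisymm
    · rw [Subfield.closure_le]
      rintro _ (⟨c, rfl⟩ | ⟨f, ⟨hf, -⟩, rfl⟩) g
      · exact (hcompat g (C c)).trans (by rw [hC]; rfl)
      · exact (hcompat g f).trans (by rw [hf])
    · intro x hx
      obtain ⟨p, q, hp, hq, rfl⟩ := exists_invariant_div_eq hcompat hx
      set K := Subfield.closure (Set.range (A.comp C) ∪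
        A '' {f : MvPolynomial (Fin N) k | (∀ g : G, g • f = f) ∧ f.totalDegree ≤ d})
      have hK (c : k) : A (C c) ∈ K := Subfield.subset_closure (Or.inl ⟨c, rfl⟩)
      have hM (a : Fin N → ℤ) (ha : a ∈ L) : laurentMonomial (k := k) F a ∈ K := by
        rw [← h] at ha
        induction ha using AddSubgroup.closure_induction with
        | mem a ha =>
          obtain ⟨haL, ha0, had⟩ := ha
          let m : Fin N →₀ ℕ := Finsupp.equivFunOnFinite.symm fun i => (a i).toNat
          have hm : (fun i => (m i : ℤ)) = a := funext fun i => Int.toNat_of_nonneg (ha0 i)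
          have hsum : ∑ i, (m i : ℤ) ≤ d := by simpa only [← hm] using had
          rw [← hm, ← algebraMap_monomial_one]
          refine Subfield.subset_closure (Or.inr ⟨_, ⟨(hinv _).2 fun u hu => ?_, ?_⟩, rfl⟩)
          · rw [coeff_monomial] at hu
            obtain rfl : m = u := by by_contra h; simp [h] at hu
            rwa [hm]
          · rw [totalDegree_monomial _ one_ne_zero, Finsupp.sum_fintype _ _ fun _ => rfl]
            exact_mod_cast hsum
        | zero => rw [laurentMonomial_zero]; exact K.one_mem
        | add a b _ _ ha hb => rw [laurentMonomial_add]; exact K.mul_mem ha hb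
        | neg a _ ha => rw [laurentMonomial_neg]; exact K.inv_mem ha
      exact K.div_mem (algebraMap_mem_of_mem_expSupported hK hM ((hinv p).1 hp))
        (algebraMap_mem_of_mem_expSupported hK hM ((hinv q).1 hq))
end
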